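/- Let d ≥ 1, 0 < q₁ < q₂ < ∞, μ ∈ ℤ, and A > 0. Then there is a constant C, independent of μ and of the family (f_k), such that: for every sequence (f_k)_{k∈ℤ} of tempered distributions with supp f̂_k ⊂ {ξ : |ξ| ≤ 2A·2^k} for all k (so that each f_k is a smooth function of polynomial growth), one has V_{μ,q₂}[(f_k)] ≤ C · V_{μ,q₁}[(f_k)], where V_{μ,q}[(f_k)] := sup over dyadic cubes P with side length l(P) ≤ 2^{−μ} of (|P|^{−1} ∫_P Σ_{k=−log₂ l(P)}^∞ |f_k(x)|^q dx)^{1/q}. -/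

import Mathlib

noncomputable section

open MeasureTheory SchwartzMap Complex RealInnerProductSpace Filter
open scoped ENNReal NNReal ContDiff SchwartzMap

/-- Euclidean space `ℝ^d`. -/
abbrev RD (d : ℕ) : Type := EuclideanSpace ℝ (Fin d)

/-- Tempered distributions on `ℝ^d`. -/
abbrev TD (d : ℕ) : Type := 𝓢(RD d, ℂ) →L[ℂ] ℂ

/-- Fourier transform of a Schwartz function (with the convention
`f̂(ξ) = ∫ f(x) e^{-2πi⟨x,ξ⟩} dx`). -/
def fourierS {d : ℕ} (f : 𝓢(RD d, ℂ)) : 𝓢(RD d, ℂ) :=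
  SchwartzMap.fourierTransformCLM ℂ f

/-- Hörmander symbol class `S^m_{1,1}`: `a` is smooth and
`‖∂_ξ^α ∂_x^β a(x,ξ)‖ ≤ c_{α,β} (1+‖ξ‖)^{m-|α|+|β|}` for all orders of derivatives. -/
def IsSymbolS11 (d : ℕ) (m : ℝ) (a : RD d → RD d → ℂ) : Prop :=
  ContDiff ℝ ∞ (fun p : RD d × RD d => a p.1 p.2) ∧
  ∀ α β : ℕ, ∃ c : ℝ, ∀ x ξ : RD d,
    ‖iteratedFDeriv ℝ α (fun ξ' => iteratedFDeriv ℝ β (fun x' => a x' ξ') x) ξ‖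
      ≤ c * (1 + ‖ξ‖) ^ (m - (α : ℝ) + (β : ℝ))

/-- The pseudo-differential operator `T_a f(x) = ∫ a(x,ξ) f̂(ξ) e^{2πi⟨x,ξ⟩} dξ`
acting on a Schwartz function `f`. -/
def pdo {d : ℕ} (a : RD d → RD d → ℂ) (f : 𝓢(RD d, ℂ)) (x : RD d) : ℂ :=
  ∫ ξ, a x ξ * fourierS f ξ * Complex.exp (2 * Real.pi * Complex.I * ((⟪x, ξ⟫ : ℝ) : ℂ))

/-- Littlewood–Paley data: a Schwartz function `φ` with `φ̂` supported in
`{1/2 ≤ |ξ| ≤ 2}` and `Σ_{k∈ℤ} φ̂(2^{-k}ξ) = 1` for `ξ ≠ 0`, together with the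
low-frequency piece `Φ` determined by `Φ̂ = 1 - Σ_{k≥1} φ̂(2^{-k}·)`. -/
structure LPData (d : ℕ) where
  φ : 𝓢(RD d, ℂ)
  Φ : 𝓢(RD d, ℂ)
  supp_φ : ∀ ξ : RD d, fourierS φ ξ ≠ 0 → 1/2 ≤ ‖ξ‖ ∧ ‖ξ‖ ≤ 2
  sum_φ : ∀ ξ : RD d, ξ ≠ 0 → HasSum (fun k : ℤ => fourierS φ ((2:ℝ)^(-k) • ξ)) 1
  Φ_def : ∀ ξ : RD d, fourierS Φ ξ = 1 - ∑' k : ℕ, fourierS φ (((2:ℝ)^(k+1))⁻¹ • ξ)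

/-- The Littlewood–Paley convolution kernel: `Φ` for `k = 0` and
`φ_k = 2^{kd} φ(2^k ·)` for `k ≥ 1`. -/
def LPkernel {d : ℕ} (D : LPData d) : ℕ → RD d → ℂ
  | 0, x => D.Φ x
  | (k+1), x => (((2:ℝ)^((k+1) * d) : ℝ) : ℂ) * D.φ ((2:ℝ)^(k+1) • x)

/-- The Fourier transform of the `k`-th Littlewood–Paley kernel, i.e. `φ̂_k = φ̂(2^{-k}·)`
for `k ≥ 1` and `Φ̂` for `k = 0`. -/
def LPhat {d : ℕ} (D : LPData d) : ℕ → RD d → ℂ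
  | 0, ξ => fourierS D.Φ ξ
  | (k+1), ξ => fourierS D.φ (((2:ℝ)^(k+1))⁻¹ • ξ)

/-- Littlewood–Paley operator `Π_k g = φ_k ∗ g` (with `φ_0 := Φ`) acting on functions. -/
def LP {d : ℕ} (D : LPData d) (k : ℕ) (g : RD d → ℂ) (x : RD d) : ℂ :=
  ∫ y, LPkernel D k y * g (x - y)

/-- `Π*_k = Π_{k-1} + Π_k + Π_{k+1}` (with the convention `φ_{-1} := 0`). -/
def LPstar {d : ℕ} (D : LPData d) (k : ℕ) (g : RD d → ℂ) (x : RD d) : ℂ :=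
  (if k = 0 then 0 else LP D (k-1) g x) + LP D k g x + LP D (k+1) g x

open Classical in
/-- Pairing of a tempered distribution with a plain function: it gives `u ψ` if the
function is (the coercion of) a Schwartz function `ψ`, and `0` otherwise. -/
def pairing {d : ℕ} (u : TD d) (g : RD d → ℂ) : ℂ :=
  if h : ∃ ψ : 𝓢(RD d, ℂ), ⇑ψ = g then u h.choose else 0

/-- Fourier transform of a tempered distribution, `⟨û, ψ⟩ = ⟨u, ψ̂⟩`. -/
def fourierTD {d : ℕ} (u : TD d) : TD d :=
  u.comp (SchwartzMap.fourierTransformCLM ℂ)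

/-- Littlewood–Paley operator on tempered distributions:
`Π_k u (x) = ⟨u, φ_k(x - ·)⟩`. -/
def LPdist {d : ℕ} (D : LPData d) (k : ℕ) (u : TD d) (x : RD d) : ℂ :=
  pairing u (fun y => LPkernel D k (x - y))

/-- The symbol `a_{j,k}(x,ξ) = (φ_j ∗ a(·,ξ))(x) · φ̂_k(ξ)` (with `Φ` replacing `φ_0`). -/
def symbolPiece {d : ℕ} (D : LPData d) (a : RD d → RD d → ℂ) (j k : ℕ)
    (x ξ : RD d) : ℂ :=
  (∫ y, LPkernel D j y * a (x - y) ξ) * LPhat D k ξ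

/-- `T_{a_{j,k}} u (x) = ⟨û, a_{j,k}(x,·) e^{2πi⟨x,·⟩}⟩` for a tempered distribution `u`. -/
def pdoPieceD {d : ℕ} (D : LPData d) (a : RD d → RD d → ℂ) (j k : ℕ)
    (u : TD d) (x : RD d) : ℂ :=
  pairing (fourierTD u)
    (fun ξ => symbolPiece D a j k x ξ * Complex.exp (2 * Real.pi * Complex.I * ((⟪x, ξ⟫ : ℝ) : ℂ)))

/-- Partial sums `Σ_{j=0}^N Σ_{k=0}^N T_{a_{j,k}} u (x)`. -/
def pdoPartial {d : ℕ} (D : LPData d) (a : RD d → RD d → ℂ) (N : ℕ)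
    (u : TD d) (x : RD d) : ℂ :=
  ∑ j ∈ Finset.range (N+1), ∑ k ∈ Finset.range (N+1), pdoPieceD D a j k u x

/-- `T_a u` converges in `S'` to the tempered distribution `Tf`: the partial sums
`Σ_{j,k≤N} T_{a_{j,k}} u` (which are functions) converge to `Tf` weakly. -/
def ConvergesInSPrime {d : ℕ} (D : LPData d) (a : RD d → RD d → ℂ)
    (u : TD d) (Tf : TD d) : Prop :=
  ∀ ψ : 𝓢(RD d, ℂ),
    Tendsto (fun N => ∫ x, pdoPartial D a N u x * ψ x) atTop (nhds (Tf ψ))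

/-- The dyadic cube of level `ν` (side length `2^{-ν}`) indexed by `n ∈ ℤ^d`. -/
def dyadicCube (d : ℕ) (ν : ℤ) (n : Fin d → ℤ) : Set (RD d) :=
  {x | ∀ i, (n i : ℝ) * (2:ℝ)^(-ν) ≤ x i ∧ x i < ((n i : ℝ) + 1) * (2:ℝ)^(-ν)}

/-- The local quantity `(|P|⁻¹ ∫_P Σ_{k=k₀}^∞ 2^{skq} ‖g_k(x)‖^q dx)^{1/q}` for the
dyadic cube `P` of level `μ` indexed by `n` (so that `|P|⁻¹ = 2^{μd}`). -/
def cubePiece (d : ℕ) (μ : ℕ) (n : Fin d → ℤ) (k₀ : ℕ) (s q : ℝ)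
    (g : ℕ → RD d → ℂ) : ℝ≥0∞ :=
  ((2:ℝ≥0∞)^((μ:ℝ)*(d:ℝ)) *
    ∫⁻ x in dyadicCube d μ n,
      ∑' j : ℕ, (2:ℝ≥0∞)^(s*((k₀:ℝ)+(j:ℝ))*q) * (‖g (k₀+j) x‖₊ : ℝ≥0∞)^q) ^ (1/q)

/-- The `F_∞^{s,q}` norm (for `q < ∞`) of a function, computed from its
Littlewood–Paley pieces:
`‖Π_0 g‖_∞ + sup_{l(P)<1 dyadic} (|P|⁻¹ ∫_P Σ_{k=-log₂ l(P)}^∞ 2^{skq}|Π_k g|^q)^{1/q}`. -/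
def FinftyNormFun {d : ℕ} (D : LPData d) (s q : ℝ) (g : RD d → ℂ) : ℝ≥0∞ :=
  (⨆ x : RD d, (‖LP D 0 g x‖₊ : ℝ≥0∞)) +
  ⨆ (μ : ℕ) (_ : 1 ≤ μ) (n : Fin d → ℤ),
    cubePiece d μ n μ s q (fun k x => LP D k g x)

/-- The `F_∞^{s,q}` norm (for `q < ∞`) of a tempered distribution. -/
def FinftyNormDist {d : ℕ} (D : LPData d) (s q : ℝ) (u : TD d) : ℝ≥0∞ :=
  (⨆ x : RD d, (‖LPdist D 0 u x‖₊ : ℝ≥0∞)) +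
  ⨆ (μ : ℕ) (_ : 1 ≤ μ) (n : Fin d → ℤ),
    cubePiece d μ n μ s q (fun k x => LPdist D k u x)

/-- The (axis-parallel, closed) cube with corner `c` and side length `L`. -/
def cube (d : ℕ) (c : RD d) (L : ℝ) : Set (RD d) :=
  {x | ∀ i, c i ≤ x i ∧ x i ≤ c i + L}

/-- The average of `g` over the cube with corner `c` and side length `L`. -/
def cubeMean {d : ℕ} (c : RD d) (L : ℝ) (g : RD d → ℂ) : ℂ :=
  (L^d)⁻¹ • ∫ x in cube d c L, g x

/-- The `bmo` norm (local BMO):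
`sup_{l(Q)≥1} |Q|⁻¹∫_Q |g| + sup_{l(Q)<1} |Q|⁻¹∫_Q |g - g_Q|`, over all cubes `Q`. -/
def bmoNorm (d : ℕ) (g : RD d → ℂ) : ℝ≥0∞ :=
  (⨆ (c : RD d) (L : ℝ) (_ : 1 ≤ L),
    ENNReal.ofReal ((L^d)⁻¹) * ∫⁻ x in cube d c L, (‖g x‖₊ : ℝ≥0∞)) +
  (⨆ (c : RD d) (L : ℝ) (_ : 0 < L) (_ : L < 1),
    ENNReal.ofReal ((L^d)⁻¹) * ∫⁻ x in cube d c L, (‖g x - cubeMean c L g‖₊ : ℝ≥0∞))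

/-- The Peetre maximal function `𝔐_{σ,R} g(x) = sup_y ‖g(x-y)‖/(1+R‖y‖)^σ`. -/
def peetre {d : ℕ} (σ R : ℝ) (g : RD d → ℂ) (x : RD d) : ℝ≥0∞ :=
  ⨆ y : RD d, (‖g (x - y)‖₊ : ℝ≥0∞) / ENNReal.ofReal ((1 + R * ‖y‖) ^ σ)

/-- `g` has (distributional) Fourier support contained in `K`: the pairing
`⟨ĝ, ψ⟩ = ∫ g · ψ̂` vanishes for every Schwartz `ψ` whose support does not meet `K`. -/
def HasFourierSupportIn {d : ℕ} (g : RD d → ℂ) (K : Set (RD d)) : Prop :=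
  ∀ ψ : 𝓢(RD d, ℂ), tsupport ⇑ψ ∩ K = ∅ → ∫ x, g x * fourierS ψ x = 0

/-- `V_{μ,q}[(f_k)]`: the supremum, over all dyadic cubes `P` of side length `≤ 2^{-μ}`
(level `ν ≥ μ`), of `(|P|⁻¹ ∫_P Σ_{k = -log₂ l(P)}^∞ ‖f_k(x)‖^q dx)^{1/q}`. -/
def VNorm (d : ℕ) (μ : ℤ) (q : ℝ) (F : ℤ → RD d → ℂ) : ℝ≥0∞ :=
  ⨆ (ν : ℤ) (_ : μ ≤ ν) (n : Fin d → ℤ),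
    ((2:ℝ≥0∞)^((ν:ℝ)*(d:ℝ)) *
      ∫⁻ x in dyadicCube d ν n, ∑' j : ℕ, (‖F (ν + (j:ℤ)) x‖₊ : ℝ≥0∞)^q) ^ (1/q)

lemma mem_dyadicCube_iff {d : ℕ} {ν : ℤ} {n : Fin d → ℤ} {x : RD d} :
    x ∈ dyadicCube d ν n ↔ ∀ i, ⌊x i * (2:ℝ)^ν⌋ = n i := by
  have h : (0:ℝ) < (2:ℝ)^ν := by positivity
  simp only [dyadicCube, Set.mem_ofPred_eq, Int.floor_eq_iff, zpow_neg, ← div_eq_mul_inv,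
    div_le_iff₀ h, lt_div_iff₀ h]

lemma iUnion_dyadicCube (d : ℕ) (ν : ℤ) : ⋃ n, dyadicCube d ν n = Set.univ := by
  refine Set.eq_univ_of_forall fun x => Set.mem_iUnion.2 ⟨fun i => ⌊x i * (2:ℝ)^ν⌋, ?_⟩
  exact mem_dyadicCube_iff.2 fun _ => rfl

lemma pairwise_disjoint_dyadicCube (d : ℕ) (ν : ℤ) :
    Pairwise (Function.onFun Disjoint (dyadicCube d ν)) := by
  intro m n hmn
  refine Set.disjoint_left.2 fun x hx hx' => hmn (funext fun i => ?_)
  rw [← mem_dyadicCube_iff.1 hx i, mem_dyadicCube_iff.1 hx' i]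

lemma dyadicCube_eq_preimage (d : ℕ) (ν : ℤ) (n : Fin d → ℤ) :
    dyadicCube d ν n = (WithLp.ofLp : RD d → Fin d → ℝ) ⁻¹'
      (Set.univ.pi fun i => Set.Ico ((n i : ℝ) * (2:ℝ)^(-ν)) (((n i : ℝ) + 1) * (2:ℝ)^(-ν))) := by
  ext x
  simp [dyadicCube]

lemma measurableSet_dyadicCube (d : ℕ) (ν : ℤ) (n : Fin d → ℤ) :
    MeasurableSet (dyadicCube d ν n) := by
  rw [dyadicCube_eq_preimage]
  exact (PiLp.volume_preserving_ofLp (Fin d)).measurable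
    (MeasurableSet.univ_pi fun _ => measurableSet_Ico)

lemma two_rpow_intCast_mul_natCast (ν : ℤ) (d : ℕ) :
    (2:ℝ≥0∞)^((ν:ℝ)*(d:ℝ)) = ENNReal.ofReal (((2:ℝ)^ν)^d) := by
  rw [ENNReal.rpow_mul, ENNReal.rpow_natCast, ENNReal.rpow_intCast,
    ENNReal.ofReal_pow (by positivity)]
  congr 1
  rw [← Real.rpow_intCast, ← ENNReal.ofReal_rpow_of_pos two_pos, ENNReal.rpow_intCast]
  norm_num

lemma two_rpow_mul_volume_dyadicCube (d : ℕ) (ν : ℤ) (n : Fin d → ℤ) :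
    (2:ℝ≥0∞)^((ν:ℝ)*(d:ℝ)) * volume (dyadicCube d ν n) = 1 := by
  rw [two_rpow_intCast_mul_natCast, dyadicCube_eq_preimage,
    (PiLp.volume_preserving_ofLp (Fin d)).measure_preimage
      (MeasurableSet.univ_pi fun _ => measurableSet_Ico).nullMeasurableSet, Real.volume_pi_Ico]
  have : ∀ i, ((n i : ℝ) + 1) * (2:ℝ)^(-ν) - (n i : ℝ) * (2:ℝ)^(-ν) = ((2:ℝ)^ν)⁻¹ := by
    intro i; rw [zpow_neg]; ring
  simp only [this, Finset.prod_const, Finset.card_univ, Fintype.card_fin]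
  rw [← ENNReal.ofReal_pow (by positivity), ← ENNReal.ofReal_mul (by positivity), ← mul_pow,
    mul_inv_cancel₀ (by positivity)]
  simp

lemma two_zpow_mul_norm_sub_le {d : ℕ} {ν : ℤ} {n : Fin d → ℤ} {x y : RD d}
    (hx : x ∈ dyadicCube d ν n) (hy : y ∈ dyadicCube d ν n) :
    (2:ℝ)^ν * ‖x - y‖ ≤ d := by
  have h : (0:ℝ) < (2:ℝ)^ν := by positivity
  have hcoord : ∀ i, |(2:ℝ)^ν * (x - y) i| ≤ 1 := by
    intro i
    have h1 := Int.floor_eq_iff.1 (mem_dyadicCube_iff.1 hx i)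
    have h2 := Int.floor_eq_iff.1 (mem_dyadicCube_iff.1 hy i)
    rw [PiLp.sub_apply, abs_le]
    constructor <;> nlinarith
  have hsq : ((2:ℝ)^ν * ‖x - y‖)^2 ≤ (d:ℝ)^2 := by
    rw [mul_pow, EuclideanSpace.real_norm_sq_eq, Finset.mul_sum]
    calc ∑ i, ((2:ℝ)^ν)^2 * (x - y) i ^ 2 ≤ ∑ _i : Fin d, (1:ℝ) := by
          refine Finset.sum_le_sum fun i _ => ?_
          rw [← mul_pow, sq_le_one_iff_abs_le_one]
          exact hcoord i
      _ = d := by simp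
      _ ≤ (d:ℝ)^2 := by exact_mod_cast Nat.le_self_pow two_ne_zero d
  exact abs_le_of_sq_le_sq' hsq (by positivity) |>.2

lemma two_rpow_mul_lintegral_comp (d : ℕ) (ν : ℤ) (h : RD d → ℝ≥0∞) (x : RD d) :
    (2:ℝ≥0∞)^((ν:ℝ)*(d:ℝ)) * ∫⁻ y, h ((2:ℝ)^ν • (y - x)) = ∫⁻ u, h u := by
  have h2 : (2:ℝ)^ν ≠ 0 := by positivity
  rw [lintegral_sub_right_eq_self (fun y => h ((2:ℝ)^ν • y)) x]
  let e : RD d ≃ᵐ RD d := (Homeomorph.smulOfNeZero ((2:ℝ)^ν) h2).toMeasurableEquiv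
  have hm := lintegral_map_equiv (μ := (volume : Measure (RD d))) h e
  have he : (⇑e : RD d → RD d) = ((2:ℝ)^ν • ·) := rfl
  rw [he, Measure.map_addHaar_smul _ h2, lintegral_smul_measure] at hm
  rw [← hm, two_rpow_intCast_mul_natCast, smul_eq_mul, ← mul_assoc,
    ← ENNReal.ofReal_mul (by positivity), finrank_euclideanSpace_fin, abs_of_pos (by positivity),
    mul_inv_cancel₀ (by positivity), ENNReal.ofReal_one, one_mul]

/-- The weight `(1 + ‖u‖)^{-(d+1)}`, integrable on `ℝ^d`. -/
def decayWeight (d : ℕ) (u : RD d) : ℝ≥0∞ :=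
  ENNReal.ofReal ((1 + ‖u‖) ^ (-((d:ℝ) + 1)))

lemma lintegral_decayWeight_lt_top (d : ℕ) : ∫⁻ u, decayWeight d u < ⊤ := by
  refine finite_integral_one_add_norm (E := RD d) (μ := volume) (r := (d:ℝ) + 1) ?_
  simp

lemma decayWeight_comp_le {d : ℕ} {ν : ℤ} {n : Fin d → ℤ} {x y z : RD d}
    (hy : y ∈ dyadicCube d ν n) (hz : z ∈ dyadicCube d ν n) :
    decayWeight d ((2:ℝ)^ν • (y - x)) ≤
      ENNReal.ofReal ((1 + d : ℝ) ^ ((d:ℝ) + 1)) * decayWeight d ((2:ℝ)^ν • (z - x)) := by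
  have h : (0:ℝ) < (2:ℝ)^ν := by positivity
  rw [decayWeight, decayWeight, ← ENNReal.ofReal_mul (by positivity)]
  refine ENNReal.ofReal_le_ofReal ?_
  rw [Real.rpow_neg (by positivity), Real.rpow_neg (by positivity), ← div_eq_mul_inv,
    le_div_iff₀ (by positivity), inv_mul_le_iff₀ (by positivity), ← Real.mul_rpow (by positivity)
    (by positivity)]
  refine Real.rpow_le_rpow (by positivity) ?_ (by positivity)
  have h1 := two_zpow_mul_norm_sub_le hz hy
  have h2 : ‖z - x‖ ≤ ‖z - y‖ + ‖y - x‖ := norm_sub_le_norm_sub_add_norm_sub z y x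
  simp only [norm_smul, Real.norm_of_nonneg h.le]
  have h3 : 0 ≤ (2:ℝ)^ν * ‖y - x‖ := by positivity
  have h4 : (0:ℝ) ≤ d := by positivity
  nlinarith [mul_le_mul_of_nonneg_left h2 h.le, mul_nonneg h3 h4]

/-- The integral of a function against a dilated decaying weight is controlled by its averages over
dyadic cubes. -/
lemma two_rpow_mul_lintegral_mul_decayWeight_le (d : ℕ) (ν : ℤ) (g : RD d → ℝ≥0∞)
    (S : ℝ≥0∞)
    (hS : ∀ n, (2:ℝ≥0∞)^((ν:ℝ)*(d:ℝ)) * ∫⁻ y in dyadicCube d ν n, g y ≤ S) (x : RD d) :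
    (2:ℝ≥0∞)^((ν:ℝ)*(d:ℝ)) * ∫⁻ y, g y * decayWeight d ((2:ℝ)^ν • (y - x)) ≤
      ENNReal.ofReal ((1 + d : ℝ) ^ ((d:ℝ) + 1)) * (∫⁻ u, decayWeight d u) * S := by
  set D := ENNReal.ofReal ((1 + d : ℝ) ^ ((d:ℝ) + 1))
  set a := (2:ℝ≥0∞)^((ν:ℝ)*(d:ℝ)) with ha
  have hDtop : D ≠ ⊤ := ENNReal.ofReal_ne_top
  set w : RD d → ℝ≥0∞ := fun y => decayWeight d ((2:ℝ)^ν • (y - x)) with hw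
  have split : ∀ φ : RD d → ℝ≥0∞, ∫⁻ y, φ y = ∑' n, ∫⁻ y in dyadicCube d ν n, φ y := by
    intro φ
    rw [← lintegral_iUnion (measurableSet_dyadicCube d ν) (pairwise_disjoint_dyadicCube d ν),
      iUnion_dyadicCube, setLIntegral_univ]
  have avg : ∀ n, ∀ y ∈ dyadicCube d ν n, w y ≤ D * (a * ∫⁻ z in dyadicCube d ν n, w z) := by
    intro n y hy
    calc w y = a * ∫⁻ _ in dyadicCube d ν n, w y := by
          rw [setLIntegral_const, mul_comm (w y), ← mul_assoc, two_rpow_mul_volume_dyadicCube,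
            one_mul]
      _ ≤ a * ∫⁻ z in dyadicCube d ν n, D * w z := by
          gcongr 1
          exact setLIntegral_mono' (measurableSet_dyadicCube d ν n)
            fun z hz => decayWeight_comp_le hy hz
      _ = D * (a * ∫⁻ z in dyadicCube d ν n, w z) := by
          rw [lintegral_const_mul' _ _ hDtop]; ring
  calc a * ∫⁻ y, g y * w y
      = ∑' n, a * ∫⁻ y in dyadicCube d ν n, g y * w y := by rw [split, ENNReal.tsum_mul_left]
    _ ≤ ∑' n, D * a * S * ∫⁻ z in dyadicCube d ν n, w z := by
        refine ENNReal.tsum_le_tsum fun n => ?_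
        set m := D * (a * ∫⁻ z in dyadicCube d ν n, w z) with hm
        have hmtop : m ≠ ⊤ := by
          refine ENNReal.mul_ne_top hDtop ?_
          rw [hw]
          refine ((mul_le_mul_right (setLIntegral_le_lintegral _ _) a).trans_lt ?_).ne
          rw [ha, two_rpow_mul_lintegral_comp d ν (decayWeight d) x]
          exact lintegral_decayWeight_lt_top d
        calc a * ∫⁻ y in dyadicCube d ν n, g y * w y
            ≤ a * ∫⁻ y in dyadicCube d ν n, g y * m := by
              gcongr 1
              exact setLIntegral_mono' (measurableSet_dyadicCube d ν n)
                fun y hy => mul_le_mul_right (avg n y hy) _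
          _ = m * (a * ∫⁻ y in dyadicCube d ν n, g y) := by
              rw [lintegral_mul_const' _ _ hmtop]; ring
          _ ≤ m * S := by gcongr; exact hS n
          _ = D * a * S * ∫⁻ z in dyadicCube d ν n, w z := by rw [hm]; ring
    _ = D * S * (a * ∫⁻ y, w y) := by rw [ENNReal.tsum_mul_left, ← split]; ring
    _ = D * (∫⁻ u, decayWeight d u) * S := by
        rw [hw, ha, two_rpow_mul_lintegral_comp d ν (decayWeight d) x]; ring

/-- The Schwartz function `ξ ↦ e^{2πi⟨x,ξ⟩} χ(aξ)`, for a compactly supported Schwartz function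
`χ`. -/
def modulatedDilation {d : ℕ} (χ : 𝓢(RD d, ℂ)) (hχ : HasCompactSupport χ) (x : RD d) {a : ℝ}
    (ha : a ≠ 0) : 𝓢(RD d, ℂ) :=
  HasCompactSupport.toSchwartzMap
    (f := fun ξ => Complex.exp ((2 * Real.pi * ⟪x, ξ⟫ : ℝ) * Complex.I) * χ (a • ξ))
    ((hχ.comp_smul ha).mul_left)
    (by
      have h1 : ContDiff ℝ ∞ χ := χ.smooth'
      have h2 : ContDiff ℝ ∞ (fun ξ : RD d => ((2 * Real.pi * ⟪x, ξ⟫ : ℝ) : ℂ)) :=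
        Complex.ofRealCLM.contDiff.comp (contDiff_const.mul (contDiff_const.inner ℝ contDiff_id))
      exact (h2.mul contDiff_const).cexp.mul (h1.comp (contDiff_const_smul a)))

lemma modulatedDilation_apply {d : ℕ} (χ : 𝓢(RD d, ℂ)) (hχ : HasCompactSupport χ) (x : RD d)
    {a : ℝ} (ha : a ≠ 0) (ξ : RD d) :
    modulatedDilation χ hχ x ha ξ =
      Complex.exp ((2 * Real.pi * ⟪x, ξ⟫ : ℝ) * Complex.I) * χ (a • ξ) := rfl

lemma fourierS_apply {d : ℕ} (f : 𝓢(RD d, ℂ)) (y : RD d) :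
    fourierS f y = ∫ ξ, Complex.exp (↑(-2 * Real.pi * ⟪ξ, y⟫) * Complex.I) • f ξ := by
  rw [fourierS, SchwartzMap.fourierTransformCLM_apply, SchwartzMap.fourier_coe, Real.fourier_eq']

lemma fourierS_modulatedDilation {d : ℕ} (χ : 𝓢(RD d, ℂ)) (hχ : HasCompactSupport χ)
    (x : RD d) {a : ℝ} (ha : 0 < a) (y : RD d) :
    fourierS (modulatedDilation χ hχ x ha.ne') y =
      (((a ^ d)⁻¹ : ℝ) : ℂ) * fourierS χ (a⁻¹ • (y - x)) := by
  rw [fourierS_apply, fourierS_apply]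
  have key := Measure.integral_comp_smul (volume : Measure (RD d))
    (fun η => Complex.exp (↑(-2 * Real.pi * ⟪η, a⁻¹ • (y - x)⟫) * Complex.I) • χ η) a
  rw [finrank_euclideanSpace_fin, abs_of_pos (by positivity), Complex.real_smul] at key
  rw [← key]
  congr 1
  ext ξ
  rw [modulatedDilation_apply, smul_eq_mul, smul_eq_mul, ← mul_assoc, ← Complex.exp_add]
  congr 2
  rw [real_inner_smul_left, real_inner_smul_right, inner_sub_right, mul_inv_cancel_left₀ ha.ne',
    real_inner_comm x ξ]
  push_cast
  ring

lemma integral_fourierS {d : ℕ} (χ : 𝓢(RD d, ℂ)) : ∫ u, fourierS χ u = χ 0 := by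
  have h : FourierTransformInv.fourierInv (fourierS χ) = χ :=
    FourierTransform.fourierInv_fourier_eq (F := 𝓢(RD d, ℂ)) χ
  conv_rhs => rw [← h, SchwartzMap.fourierInv_coe, Real.fourierInv_eq']
  simp

lemma integrable_mul_schwartz {d : ℕ} {f : RD d → ℂ} (hf : Function.HasTemperateGrowth f)
    (ψ : 𝓢(RD d, ℂ)) : Integrable fun y => f y * ψ y := by
  have h := (SchwartzMap.smulLeftCLM ℂ f ψ).integrable (μ := (volume : Measure (RD d)))
  refine h.congr (Eventually.of_forall fun y => ?_)
  simp [SchwartzMap.smulLeftCLM_apply_apply hf]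

lemma exists_norm_le_of_hasTemperateGrowth {d : ℕ} {f : RD d → ℂ}
    (hf : Function.HasTemperateGrowth f) :
    ∃ (N : ℕ) (K : ℝ), 0 ≤ K ∧ ∀ y, ‖f y‖ ≤ K * (1 + ‖y‖) ^ N := by
  obtain ⟨N, K, h⟩ := hf.2 0
  refine ⟨N, K, ?_, fun y => by simpa using h y⟩
  have h0 := h 0
  simp only [norm_zero, add_zero, one_pow, mul_one] at h0
  exact (norm_nonneg _).trans h0

lemma tendsto_integral_comp_add_smul_mul {d : ℕ} {f : RD d → ℂ}
    (hf : Function.HasTemperateGrowth f) (h : 𝓢(RD d, ℂ)) (x : RD d) :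
    Tendsto (fun a : ℝ => ∫ u, f (x + a • u) * h u) (nhdsWithin 0 (Set.Ioi 0))
      (nhds (f x * ∫ u, h u)) := by
  obtain ⟨N, K, hK, hfK⟩ := exists_norm_le_of_hasTemperateGrowth hf
  have hfc : Continuous f := hf.1.continuous
  rw [← integral_const_mul]
  refine tendsto_integral_filter_of_dominated_convergence
    (fun u => K * (1 + ‖x‖) ^ N * (2 ^ (N - 1) * (‖h u‖ + ‖u‖ ^ N * ‖h u‖))) ?_ ?_ ?_ ?_
  · refine Eventually.of_forall fun a => Continuous.aestronglyMeasurable ?_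
    exact (hfc.comp (by fun_prop)).mul h.continuous
  · filter_upwards [Ioo_mem_nhdsGT (zero_lt_one (α := ℝ))] with a ha
    refine Eventually.of_forall fun u => ?_
    rw [norm_mul]
    have h1 : (1 + ‖x + a • u‖) ≤ (1 + ‖x‖) * (1 + ‖u‖) := by
      have := norm_add_le x (a • u)
      rw [norm_smul, Real.norm_of_nonneg ha.1.le] at this
      nlinarith [ha.2, norm_nonneg u, norm_nonneg x, mul_nonneg (norm_nonneg x) (norm_nonneg u)]
    have h2 : (1 + ‖u‖) ^ N ≤ 2 ^ (N - 1) * (1 + ‖u‖ ^ N) := by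
      simpa using add_pow_le zero_le_one (norm_nonneg u) N
    calc ‖f (x + a • u)‖ * ‖h u‖ ≤ K * ((1 + ‖x‖) * (1 + ‖u‖)) ^ N * ‖h u‖ := by
          gcongr
          exact (hfK _).trans (by gcongr)
      _ ≤ K * ((1 + ‖x‖) ^ N * (2 ^ (N - 1) * (1 + ‖u‖ ^ N))) * ‖h u‖ := by
          rw [mul_pow]; gcongr
      _ = _ := by ring
  · exact ((h.integrable.norm.add (h.integrable_pow_mul volume N)).const_mul _).const_mul _
  · refine Eventually.of_forall fun u => Tendsto.mul_const _ ?_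
    have hc : Continuous fun a : ℝ => f (x + a • u) := hfc.comp (by fun_prop)
    have := (hc.tendsto 0).mono_left (nhdsWithin_le_nhds (s := Set.Ioi 0))
    simpa using this

lemma integral_mul_fourierS_modulatedDilation {d : ℕ} (f : RD d → ℂ) (χ : 𝓢(RD d, ℂ))
    (hχ : HasCompactSupport χ) (x : RD d) {a : ℝ} (ha : 0 < a) :
    ∫ y, f y * fourierS (modulatedDilation χ hχ x ha.ne') y =
      ∫ u, f (x + a • u) * fourierS χ u := by
  have key := Measure.integral_comp_inv_smul (volume : Measure (RD d))
    (fun u => f (x + a • u) * fourierS χ u) a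
  rw [finrank_euclideanSpace_fin, abs_of_pos (by positivity)] at key
  have key2 := integral_sub_right_eq_self (μ := (volume : Measure (RD d)))
    (fun y => f (x + a • a⁻¹ • y) * fourierS χ (a⁻¹ • y)) x
  have hpos : (a ^ d) ≠ 0 := by positivity
  rw [key] at key2
  rw [← inv_smul_smul₀ hpos (∫ u, f (x + a • u) * fourierS χ u), ← key2, ← integral_smul]
  congr 1
  ext y
  rw [fourierS_modulatedDilation χ hχ x ha, smul_inv_smul₀ ha.ne', add_sub_cancel, Complex.real_smul]
  ring

/-- Reproducing formula for functions with compact Fourier support. -/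
lemma eq_integral_mul_fourierS {d : ℕ} {f : RD d → ℂ} (hf : Function.HasTemperateGrowth f)
    {R : ℝ} (hsupp : HasFourierSupportIn f {ξ | ‖ξ‖ ≤ R}) (χ : 𝓢(RD d, ℂ))
    (hχ : HasCompactSupport χ) {ρ : ℝ} (hχ1 : ∀ ξ, ‖ξ‖ ≤ ρ → χ ξ = 1) (hρ : 0 < ρ)
    {c : ℝ} (hc : 0 < c) (hcR : c * R < ρ) (x : RD d) :
    f x = ∫ y, f y * ((((c ^ d)⁻¹ : ℝ) : ℂ) * fourierS χ (c⁻¹ • (y - x))) := by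
  simp_rw [← fourierS_modulatedDilation χ hχ x hc]
  have hlim := tendsto_integral_comp_add_smul_mul hf (fourierS χ) x
  rw [integral_fourierS, hχ1 0 (by simpa using hρ.le), mul_one] at hlim
  refine tendsto_nhds_unique hlim (tendsto_const_nhds.congr' ?_)
  filter_upwards [Ioo_mem_nhdsGT hc] with a ha
  rw [← integral_mul_fourierS_modulatedDilation f χ hχ x ha.1]
  have hzero : ∀ ξ : RD d, c * ‖ξ‖ ≤ ρ →
      (modulatedDilation χ hχ x hc.ne' - modulatedDilation χ hχ x ha.1.ne') ξ = 0 := by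
    intro ξ hξ
    rw [sub_apply, modulatedDilation_apply, modulatedDilation_apply, hχ1, hχ1, sub_self]
    · rw [norm_smul, Real.norm_of_nonneg ha.1.le]
      exact (mul_le_mul_of_nonneg_right ha.2.le (norm_nonneg ξ)).trans hξ
    · rwa [norm_smul, Real.norm_of_nonneg hc.le]
  have h := hsupp (modulatedDilation χ hχ x hc.ne' - modulatedDilation χ hχ x ha.1.ne') ?_
  · have hsub : fourierS (modulatedDilation χ hχ x hc.ne' - modulatedDilation χ hχ x ha.1.ne') =
        fourierS (modulatedDilation χ hχ x hc.ne') -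
          fourierS (modulatedDilation χ hχ x ha.1.ne') := map_sub _ _ _
    rw [hsub] at h
    simp only [sub_apply, mul_sub] at h
    rw [integral_sub (integrable_mul_schwartz hf _) (integrable_mul_schwartz hf _)] at h
    exact sub_eq_zero.1 h
  · refine Set.eq_empty_iff_forall_notMem.2 fun ξ ⟨hξ, hξR⟩ => ?_
    refine (notMem_tsupport_iff_eventuallyEq.2 ?_) hξ
    have hlt : c * ‖ξ‖ < ρ := (mul_le_mul_of_nonneg_left hξR hc.le).trans_lt hcR
    have hcont : Continuous fun ξ : RD d => c * ‖ξ‖ := by fun_prop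
    filter_upwards [hcont.continuousAt.eventually (gt_mem_nhds hlt)] with η hη
    exact hzero η hη.le

/-- The polynomial weight `(1 + ‖u‖)^N`. -/
def growthWeight (d N : ℕ) (u : RD d) : ℝ≥0∞ := ENNReal.ofReal ((1 + ‖u‖) ^ N)

lemma one_le_growthWeight {d N : ℕ} (u : RD d) : 1 ≤ growthWeight d N u := by
  rw [growthWeight, ← ENNReal.ofReal_one]
  exact ENNReal.ofReal_le_ofReal (one_le_pow₀ (by linarith [norm_nonneg u]))

lemma growthWeight_ne_top {d N : ℕ} (u : RD d) : growthWeight d N u ≠ ⊤ := ENNReal.ofReal_ne_top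

lemma growthWeight_add_le {d N : ℕ} (u v : RD d) :
    growthWeight d N (u + v) ≤ growthWeight d N u * growthWeight d N v := by
  rw [growthWeight, growthWeight, growthWeight, ← ENNReal.ofReal_mul (by positivity), ← mul_pow]
  refine ENNReal.ofReal_le_ofReal (pow_le_pow_left₀ (by positivity) ?_ N)
  nlinarith [norm_add_le u v, mul_nonneg (norm_nonneg u) (norm_nonneg v)]

lemma exists_enorm_mul_growthWeight_le {d : ℕ} (h : 𝓢(RD d, ℂ)) (N : ℕ) :
    ∃ B : ℝ≥0, ∀ u, ‖h u‖ₑ * growthWeight d N u ≤ B * decayWeight d u := by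
  obtain ⟨K, hK⟩ : ∃ K : ℝ, ∀ u, (1 + ‖u‖) ^ (N + (d + 1)) * ‖h u‖ ≤ K :=
    ⟨_, fun u => by
      simpa using SchwartzMap.one_add_le_sup_seminorm_apply (𝕜 := ℝ) (m := (N + (d + 1), 0))
        le_rfl le_rfl h u⟩
  refine ⟨K.toNNReal, fun u => ?_⟩
  change _ ≤ ENNReal.ofReal K * _
  have hpos : (0:ℝ) < 1 + ‖u‖ := by positivity
  have hK0 : 0 ≤ K := le_trans (by positivity) (hK u)
  rw [growthWeight, decayWeight, ← ofReal_norm, ← ENNReal.ofReal_mul (norm_nonneg _),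
    ← ENNReal.ofReal_mul hK0]
  refine ENNReal.ofReal_le_ofReal ?_
  rw [Real.rpow_neg hpos.le, ← div_eq_mul_inv, le_div_iff₀ (by positivity)]
  have : (1 + ‖u‖) ^ ((d:ℝ) + 1) = (1 + ‖u‖) ^ (d + 1) := by
    rw [← Real.rpow_natCast]; push_cast; rfl
  rw [this, mul_assoc, ← pow_add, mul_comm]
  exact hK u

lemma enorm_le_two_rpow_mul_lintegral {d : ℕ} {f : RD d → ℂ} {h : 𝓢(RD d, ℂ)} {k : ℤ} {x : RD d}
    (hf : f x = ∫ y, f y * ((((((2:ℝ)^(-k)) ^ d)⁻¹ : ℝ) : ℂ) * h (((2:ℝ)^(-k))⁻¹ • (y - x)))) :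
    ‖f x‖ₑ ≤ (2:ℝ≥0∞)^((k:ℝ)*(d:ℝ)) * ∫⁻ y, ‖f y‖ₑ * ‖h ((2:ℝ)^k • (y - x))‖ₑ := by
  rw [two_rpow_intCast_mul_natCast, ← lintegral_const_mul' _ _ ENNReal.ofReal_ne_top]
  conv_lhs => rw [hf]
  refine (enorm_integral_le_lintegral_enorm _).trans (le_of_eq ?_)
  refine lintegral_congr fun y => ?_
  rw [zpow_neg, inv_inv, inv_pow, inv_inv, enorm_mul, enorm_mul]
  have : ‖((((2:ℝ)^k)^d : ℝ) : ℂ)‖ₑ = ENNReal.ofReal (((2:ℝ)^k)^d) := by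
    rw [← ofReal_norm, Complex.norm_real, Real.norm_of_nonneg (by positivity)]
  rw [this]
  ring

lemma rpow_le_of_le_rpow_one_sub_mul {M T : ℝ≥0∞} {r : ℝ} (hr : 0 < r) (hM : M ≠ ⊤)
    (h : M ≤ M ^ (1 - r) * T) : M ^ r ≤ T := by
  rcases eq_or_ne M 0 with rfl | h0
  · simp [ENNReal.zero_rpow_of_pos hr]
  · have h1 : M ^ (1 - r) ≠ 0 := (ENNReal.rpow_pos (pos_iff_ne_zero.2 h0) hM).ne'
    have h2 : M ^ (1 - r) ≠ ⊤ := ENNReal.rpow_ne_top_of_ne_zero h0 hM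
    refine (ENNReal.mul_le_mul_iff_right h1 h2).1 ?_
    rwa [← ENNReal.rpow_add _ _ h0 hM, sub_add_cancel, ENNReal.rpow_one]

/-- Peetre-type estimate: a function of polynomial growth reproduced by a rapidly decaying kernel is
controlled pointwise by its local `L^r` averages, `0 < r ≤ 1`. -/
lemma enorm_rpow_le_of_growth {d : ℕ} {f : RD d → ℂ} {h : 𝓢(RD d, ℂ)} {k : ℤ} {r : ℝ}
    (hr : 0 < r) (hr1 : r ≤ 1)
    (hf : ∀ z, ‖f z‖ₑ ≤
      (2:ℝ≥0∞)^((k:ℝ)*(d:ℝ)) * ∫⁻ y, ‖f y‖ₑ * ‖h ((2:ℝ)^k • (y - z))‖ₑ)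
    {N : ℕ} {B : ℝ≥0} (hB : ∀ u, ‖h u‖ₑ * growthWeight d N u ≤ B * decayWeight d u)
    {S : ℝ≥0∞}
    (hS : ∀ n, (2:ℝ≥0∞)^((k:ℝ)*(d:ℝ)) * ∫⁻ y in dyadicCube d k n, ‖f y‖ₑ ^ r ≤ S)
    (x : RD d) {M₀ : ℝ≥0∞} (hM₀ : M₀ ≠ ⊤)
    (hgrowth : ∀ z, ‖f z‖ₑ ≤ M₀ * growthWeight d N ((2:ℝ)^k • (z - x))) :
    ‖f x‖ₑ ^ r ≤
      B * (ENNReal.ofReal ((1 + d : ℝ) ^ ((d:ℝ) + 1)) * ∫⁻ u, decayWeight d u) * S := by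
  set W := ENNReal.ofReal ((1 + d : ℝ) ^ ((d:ℝ) + 1)) * ∫⁻ u, decayWeight d u
  set G : RD d → RD d → ℝ≥0∞ := fun x y => growthWeight d N ((2:ℝ)^k • (y - x)) with hG
  have hG1 : ∀ x y, 1 ≤ G x y := fun x y => one_le_growthWeight _
  have hGtop : ∀ x y, G x y ≠ ⊤ := fun x y => growthWeight_ne_top _
  have hG0 : ∀ x y, G x y ≠ 0 := fun x y => (zero_lt_one.trans_le (hG1 x y)).ne'
  have hGmul : ∀ x z y, G x y ≤ G x z * G z y := by
    intro x z y
    have : (2:ℝ)^k • (y - x) = (2:ℝ)^k • (z - x) + (2:ℝ)^k • (y - z) := by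
      rw [← smul_add]; congr 1; abel
    simp only [hG, this]
    exact growthWeight_add_le _ _
  set M : ℝ≥0∞ := ⨆ z, ‖f z‖ₑ / G x z
  have hMtop : M ≠ ⊤ := by
    refine ne_top_of_le_ne_top hM₀ (iSup_le fun z => ?_)
    exact ENNReal.div_le_of_le_mul (hgrowth z)
  have hfM : ∀ z, ‖f z‖ₑ ≤ M * G x z := fun z =>
    (ENNReal.div_le_iff (hG0 x z) (hGtop x z)).1 (le_iSup (fun z => ‖f z‖ₑ / G x z) z)
  have hr' : 0 ≤ 1 - r := sub_nonneg.2 hr1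
  have hptw : ∀ z y, ‖f y‖ₑ * ‖h ((2:ℝ)^k • (y - z))‖ₑ ≤
      M ^ (1 - r) * G x z * B * (‖f y‖ₑ ^ r * decayWeight d ((2:ℝ)^k • (y - z))) := by
    intro z y
    calc ‖f y‖ₑ * ‖h ((2:ℝ)^k • (y - z))‖ₑ
        = ‖f y‖ₑ ^ r * ‖f y‖ₑ ^ (1 - r) * ‖h ((2:ℝ)^k • (y - z))‖ₑ := by
          rw [← ENNReal.rpow_add_of_nonneg _ _ hr.le hr', add_sub_cancel, ENNReal.rpow_one]
      _ ≤ ‖f y‖ₑ ^ r * (M ^ (1 - r) * (G x z * G z y)) * ‖h ((2:ℝ)^k • (y - z))‖ₑ := by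
          gcongr
          calc ‖f y‖ₑ ^ (1 - r) ≤ (M * G x y) ^ (1 - r) := by gcongr; exact hfM y
            _ = M ^ (1 - r) * G x y ^ (1 - r) := ENNReal.mul_rpow_of_nonneg _ _ hr'
            _ ≤ M ^ (1 - r) * G x y ^ (1:ℝ) := by
                gcongr
                · exact hG1 x y
                · linarith
            _ ≤ M ^ (1 - r) * (G x z * G z y) := by
                rw [ENNReal.rpow_one]; gcongr; exact hGmul x z y
      _ = M ^ (1 - r) * G x z * ‖f y‖ₑ ^ r * (‖h ((2:ℝ)^k • (y - z))‖ₑ * G z y) := by ring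
      _ ≤ M ^ (1 - r) * G x z * ‖f y‖ₑ ^ r * (B * decayWeight d ((2:ℝ)^k • (y - z))) := by
          gcongr _ * ?_
          exact hB _
      _ = _ := by ring
  have hstep : ∀ z, ‖f z‖ₑ / G x z ≤ M ^ (1 - r) * (B * W * S) := by
    intro z
    refine ENNReal.div_le_of_le_mul ((hf z).trans ?_)
    have hc : M ^ (1 - r) * G x z * B ≠ ⊤ :=
      ENNReal.mul_ne_top (ENNReal.mul_ne_top (ENNReal.rpow_ne_top_of_nonneg hr' hMtop)
        (hGtop x z)) ENNReal.coe_ne_top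
    calc (2:ℝ≥0∞)^((k:ℝ)*(d:ℝ)) * ∫⁻ y, ‖f y‖ₑ * ‖h ((2:ℝ)^k • (y - z))‖ₑ
        ≤ (2:ℝ≥0∞)^((k:ℝ)*(d:ℝ)) * ∫⁻ y, M ^ (1 - r) * G x z * B *
            (‖f y‖ₑ ^ r * decayWeight d ((2:ℝ)^k • (y - z))) := by
          gcongr _ * ?_
          exact lintegral_mono (hptw z)
      _ = M ^ (1 - r) * G x z * B * ((2:ℝ≥0∞)^((k:ℝ)*(d:ℝ)) *
            ∫⁻ y, ‖f y‖ₑ ^ r * decayWeight d ((2:ℝ)^k • (y - z))) := by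
          rw [lintegral_const_mul' _ _ hc]; ring
      _ ≤ M ^ (1 - r) * G x z * B * (W * S) := by
          gcongr _ * ?_
          exact two_rpow_mul_lintegral_mul_decayWeight_le d k _ S hS z
      _ = M ^ (1 - r) * (B * W * S) * G x z := by ring
  have hMr : M ^ r ≤ B * W * S := rpow_le_of_le_rpow_one_sub_mul hr hMtop (iSup_le hstep)
  refine le_trans (ENNReal.rpow_le_rpow ((hfM x).trans_eq ?_) hr.le) hMr
  simp [hG, growthWeight]

lemma exists_schwartz_bump (d : ℕ) {ρ : ℝ} (hρ : 0 < ρ) :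
    ∃ χ : 𝓢(RD d, ℂ), HasCompactSupport χ ∧ ∀ ξ, ‖ξ‖ ≤ ρ → χ ξ = 1 := by
  let b : ContDiffBump (0 : RD d) := ⟨ρ, 2 * ρ, hρ, by linarith⟩
  have hb : HasCompactSupport fun ξ => ((b ξ : ℝ) : ℂ) :=
    b.hasCompactSupport.comp_left (g := fun t : ℝ => (t : ℂ)) Complex.ofReal_zero
  refine ⟨hb.toSchwartzMap (Complex.ofRealCLM.contDiff.comp b.contDiff), hb, fun ξ hξ => ?_⟩
  change ((b ξ : ℝ) : ℂ) = 1
  rw [b.one_of_mem_closedBall (by simpa using hξ), Complex.ofReal_one]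

/-- Nikolskii-type inequality: a band-limited function is bounded by its local `L^r` averages at the
scale of its band, uniformly in the scale. -/
lemma exists_enorm_rpow_le_of_fourierSupport (d : ℕ) {A r : ℝ} (hA : 0 < A) (hr : 0 < r)
    (hr1 : r ≤ 1) :
    ∃ C : ℝ≥0, ∀ (k : ℤ) (f : RD d → ℂ), Function.HasTemperateGrowth f →
      HasFourierSupportIn f {ξ : RD d | ‖ξ‖ ≤ 2 * A * (2:ℝ)^k} →
      ∀ S : ℝ≥0∞, S ≠ ⊤ →
      (∀ n, (2:ℝ≥0∞)^((k:ℝ)*(d:ℝ)) * ∫⁻ y in dyadicCube d k n, ‖f y‖ₑ ^ r ≤ S) →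
      ∀ x, ‖f x‖ₑ ^ r ≤ C * S := by
  obtain ⟨χ, hχ, hχ1⟩ := exists_schwartz_bump d (ρ := 3 * A) (by positivity)
  set W := ENNReal.ofReal ((1 + d : ℝ) ^ ((d:ℝ) + 1)) * ∫⁻ u, decayWeight d u
  have hWtop : W ≠ ⊤ :=
    ENNReal.mul_ne_top ENNReal.ofReal_ne_top (lintegral_decayWeight_lt_top d).ne
  obtain ⟨B₀, hB₀⟩ := exists_enorm_mul_growthWeight_le (fourierS χ) 0
  refine ⟨B₀ * W.toNNReal, fun k f hf hsupp S hStop hS => ?_⟩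
  have h2 : (0:ℝ) < (2:ℝ)^k := by positivity
  have hrep : ∀ z, ‖f z‖ₑ ≤
      (2:ℝ≥0∞)^((k:ℝ)*(d:ℝ)) * ∫⁻ y, ‖f y‖ₑ * ‖fourierS χ ((2:ℝ)^k • (y - z))‖ₑ := fun z =>
    enorm_le_two_rpow_mul_lintegral (eq_integral_mul_fourierS hf hsupp χ hχ hχ1 (by positivity)
      (by positivity) (by rw [zpow_neg]; field_simp; norm_num) z)
  obtain ⟨N, K, hK, hfK⟩ := exists_norm_le_of_hasTemperateGrowth hf
  obtain ⟨B, hB⟩ := exists_enorm_mul_growthWeight_le (fourierS χ) N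
  have hbdd : ∀ x, ‖f x‖ₑ ^ r ≤ B * W * S := by
    intro x
    refine enorm_rpow_le_of_growth hr hr1 hrep hB hS x (M₀ := ENNReal.ofReal
      (K * ((1 + ‖x‖) * (1 + (2:ℝ)^(-k))) ^ N)) ENNReal.ofReal_ne_top fun z => ?_
    rw [growthWeight, ← ENNReal.ofReal_mul (by positivity), ← ofReal_norm]
    refine ENNReal.ofReal_le_ofReal ((hfK z).trans ?_)
    rw [mul_assoc, ← mul_pow]
    gcongr
    rw [norm_smul, Real.norm_of_nonneg h2.le]
    have hz : ‖z‖ ≤ ‖x‖ + ‖z - x‖ := by simpa using norm_add_le x (z - x)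
    have hcancel : (2:ℝ)^(-k) * ((2:ℝ)^k * ‖z - x‖) = ‖z - x‖ := by
      rw [zpow_neg, inv_mul_cancel_left₀ h2.ne']
    have h3 : (0:ℝ) < (2:ℝ)^(-k) := by positivity
    calc 1 + ‖z‖ ≤ (1 + ‖x‖) * (1 + ‖z - x‖) := by
          nlinarith [mul_nonneg (norm_nonneg x) (norm_nonneg (z - x))]
      _ ≤ (1 + ‖x‖) * ((1 + (2:ℝ)^(-k)) * (1 + (2:ℝ)^k * ‖z - x‖)) := by
          gcongr
          have : 0 ≤ (2:ℝ)^k * ‖z - x‖ := by positivity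
          nlinarith
      _ = _ := by ring
  intro x
  have hfin : (B * W * S) ^ r⁻¹ ≠ ⊤ := ENNReal.rpow_ne_top_of_nonneg (inv_nonneg.2 hr.le)
    (ENNReal.mul_ne_top (ENNReal.mul_ne_top ENNReal.coe_ne_top hWtop) hStop)
  have := enorm_rpow_le_of_growth hr hr1 hrep hB₀ hS x hfin fun z => ?_
  · rwa [ENNReal.coe_mul, ENNReal.coe_toNNReal hWtop]
  · rw [growthWeight, pow_zero, ENNReal.ofReal_one, mul_one]
    exact (ENNReal.le_rpow_inv_iff hr).2 (hbdd z)

lemma two_rpow_mul_setLIntegral_rpow_le_of_exponent_le {d : ℕ} {ν : ℤ} {n : Fin d → ℤ}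
    {f : RD d → ℂ} (hf : Continuous f) {r q : ℝ} (hr : 0 < r) (hrq : r ≤ q) {V : ℝ≥0∞}
    (h : ((2:ℝ≥0∞)^((ν:ℝ)*(d:ℝ)) * ∫⁻ y in dyadicCube d ν n, ‖f y‖ₑ ^ q) ^ (1 / q) ≤ V) :
    (2:ℝ≥0∞)^((ν:ℝ)*(d:ℝ)) * ∫⁻ y in dyadicCube d ν n, ‖f y‖ₑ ^ r ≤ V ^ r := by
  set m : Measure (RD d) := (2:ℝ≥0∞)^((ν:ℝ)*(d:ℝ)) • volume.restrict (dyadicCube d ν n) with hm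
  have hprob : IsProbabilityMeasure m := ⟨by
    rw [hm, Measure.smul_apply, Measure.restrict_apply_univ, smul_eq_mul,
      two_rpow_mul_volume_dyadicCube]⟩
  have hint : ∀ s : ℝ, (2:ℝ≥0∞)^((ν:ℝ)*(d:ℝ)) * ∫⁻ y in dyadicCube d ν n, ‖f y‖ₑ ^ s =
      ∫⁻ y, ‖f y‖ₑ ^ s ∂m := fun s => by rw [hm, lintegral_smul_measure, smul_eq_mul]
  rw [hint] at h ⊢
  have hle := eLpNorm'_le_eLpNorm'_of_exponent_le (μ := m) hr hrq hf.aestronglyMeasurable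
  rw [eLpNorm'_eq_lintegral_enorm, eLpNorm'_eq_lintegral_enorm] at hle
  have := hle.trans h
  rwa [one_div, ENNReal.rpow_inv_le_iff hr] at this

lemma le_VNorm {d : ℕ} {μ ν : ℤ} (hν : μ ≤ ν) (n : Fin d → ℤ) (q : ℝ) (F : ℤ → RD d → ℂ) :
    ((2:ℝ≥0∞)^((ν:ℝ)*(d:ℝ)) *
      ∫⁻ x in dyadicCube d ν n, ∑' j : ℕ, (‖F (ν + (j:ℤ)) x‖₊ : ℝ≥0∞)^q) ^ (1/q) ≤
      VNorm d μ q F :=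
  le_iSup_of_le ν (le_iSup_of_le hν (le_iSup_of_le n le_rfl))

lemma single_le_VNorm {d : ℕ} {μ k : ℤ} (hk : μ ≤ k) (n : Fin d → ℤ) {q : ℝ} (hq : 0 < q)
    (F : ℤ → RD d → ℂ) :
    ((2:ℝ≥0∞)^((k:ℝ)*(d:ℝ)) * ∫⁻ x in dyadicCube d k n, ‖F k x‖ₑ ^ q) ^ (1 / q) ≤
      VNorm d μ q F := by
  refine le_trans ?_ (le_VNorm hk n q F)
  gcongr with x
  simpa [enorm_eq_nnnorm] using ENNReal.le_tsum (f := fun j : ℕ => (‖F (k + (j:ℤ)) x‖₊ : ℝ≥0∞)^q) 0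

/-- for `0 < q₁ < q₂ < ∞`, `V_{μ,q₂}[(f_k)] ≲ V_{μ,q₁}[(f_k)]` uniformly in
`μ ∈ ℤ` for families `(f_k)_{k∈ℤ}` with Fourier support in `{|ξ| ≤ 2A·2^k}`. -/
theorem statement9 (d : ℕ) (hd : 1 ≤ d) (q₁ q₂ : ℝ) (h1 : 0 < q₁) (h12 : q₁ < q₂)
    (A : ℝ) (hA : 0 < A) :
    ∃ C : ℝ≥0, ∀ (μ : ℤ) (F : ℤ → RD d → ℂ),
      (∀ k : ℤ, Function.HasTemperateGrowth (F k)) →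
      (∀ k : ℤ, HasFourierSupportIn (F k) {ξ : RD d | ‖ξ‖ ≤ 2 * A * (2:ℝ)^k}) →
      VNorm d μ q₂ F ≤ (C : ℝ≥0∞) * VNorm d μ q₁ F := by
  have hr : 0 < min q₁ 1 := lt_min h1 one_pos
  have h2 : 0 < q₂ := h1.trans h12
  obtain ⟨C₀, hC₀⟩ := exists_enorm_rpow_le_of_fourierSupport d hA hr (min_le_right _ _)
  set r := min q₁ 1
  set C₁ : ℝ≥0∞ := (C₀ : ℝ≥0∞) ^ r⁻¹
  have hC₁top : C₁ ≠ ⊤ := ENNReal.rpow_ne_top_of_nonneg (inv_nonneg.2 hr.le) ENNReal.coe_ne_top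
  set C₂ : ℝ≥0∞ := (C₁ ^ (q₂ - q₁)) ^ (1 / q₂) with hC₂
  have hC₂top : C₂ ≠ ⊤ := ENNReal.rpow_ne_top_of_nonneg (by positivity)
    (ENNReal.rpow_ne_top_of_nonneg (sub_nonneg.2 h12.le) hC₁top)
  refine ⟨C₂.toNNReal + 1, fun μ F hF hsupp => ?_⟩
  set V := VNorm d μ q₁ F
  rcases eq_or_ne V ⊤ with hVtop | hVtop
  · rw [hVtop, ENNReal.mul_top (by simp)]
    exact le_top
  have hsup : ∀ k, μ ≤ k → ∀ x, ‖F k x‖ₑ ≤ C₁ * V := by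
    intro k hk x
    have := hC₀ k (F k) (hF k) (hsupp k) (V ^ r) (ENNReal.rpow_ne_top_of_nonneg hr.le hVtop)
      (fun n => two_rpow_mul_setLIntegral_rpow_le_of_exponent_le (hF k).1.continuous hr
        (min_le_left _ _) (single_le_VNorm hk n h1 F)) x
    rw [← ENNReal.le_rpow_inv_iff hr, ENNReal.mul_rpow_of_nonneg _ _ (inv_nonneg.2 hr.le),
      ENNReal.rpow_rpow_inv hr.ne'] at this
    exact this
  have hq : 0 ≤ q₂ - q₁ := sub_nonneg.2 h12.le
  refine le_trans ?_ (mul_le_mul_left (show C₂ ≤ _ from ?_) V)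
  swap
  · rw [ENNReal.coe_add, ENNReal.coe_toNNReal hC₂top]
    exact le_self_add
  refine iSup_le fun ν => iSup_le fun hν => iSup_le fun n => ?_
  have hc : (C₁ * V) ^ (q₂ - q₁) ≠ ⊤ :=
    ENNReal.rpow_ne_top_of_nonneg hq (ENNReal.mul_ne_top hC₁top hVtop)
  have hV1 := le_VNorm hν n q₁ F
  rw [one_div, ENNReal.rpow_inv_le_iff h1] at hV1
  calc ((2:ℝ≥0∞)^((ν:ℝ)*(d:ℝ)) *
      ∫⁻ x in dyadicCube d ν n, ∑' j : ℕ, (‖F (ν + (j:ℤ)) x‖₊ : ℝ≥0∞)^q₂) ^ (1/q₂)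
      ≤ ((2:ℝ≥0∞)^((ν:ℝ)*(d:ℝ)) * ∫⁻ x in dyadicCube d ν n, (C₁ * V) ^ (q₂ - q₁) *
          ∑' j : ℕ, (‖F (ν + (j:ℤ)) x‖₊ : ℝ≥0∞)^q₁) ^ (1/q₂) := by
        gcongr with x
        rw [← ENNReal.tsum_mul_left]
        gcongr with j
        calc (‖F (ν + (j:ℤ)) x‖₊ : ℝ≥0∞)^q₂
            = (‖F (ν + (j:ℤ)) x‖₊ : ℝ≥0∞)^(q₂ - q₁) * (‖F (ν + (j:ℤ)) x‖₊ : ℝ≥0∞)^q₁ := by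
              rw [← ENNReal.rpow_add_of_nonneg _ _ hq h1.le, sub_add_cancel]
          _ ≤ _ := by
              gcongr
              exact hsup _ (by omega) x
    _ ≤ ((C₁ * V) ^ (q₂ - q₁) * V ^ q₁) ^ (1/q₂) := by
        rw [lintegral_const_mul' _ _ hc, mul_left_comm]
        gcongr
    _ = C₂ * V := by
        rw [ENNReal.mul_rpow_of_nonneg _ _ hq, mul_assoc,
          ← ENNReal.rpow_add_of_nonneg _ _ hq h1.le, sub_add_cancel,
          ENNReal.mul_rpow_of_nonneg _ _ (by positivity), one_div, ENNReal.rpow_rpow_inv h2.ne',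
          hC₂, one_div]

end
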